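/- arXiv:2502.03208 — 2 statements merged into one kernel-verified Lean document; each statement's English description precedes it below -/
import Mathlib

section
/- For every integer n ≥ 2 and all permutations σ, τ of {1,…,n}, the normalized SRD score D(σ,τ)/⌊n²/2⌋ lies in the closed interval [0,1], and it equals 0 if and only if σ = τ (the solution produces the same ranking as the reference). -/
/-- The Spearman footrule (SRD) distance between two permutations of `{1,…,n}`
(identified with `Fin n`): `D(σ,τ) = Σ_i |σ(i) − τ(i)|`. -/
def footrule {n : ℕ} (σ τ : Equiv.Perm (Fin n)) : ℤ :=
  ∑ i : Fin n, |((σ i : ℕ) : ℤ) - ((τ i : ℕ) : ℤ)|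

theorem sum_range_abs_two_mul_sub (n : ℕ) :
    ∑ i ∈ Finset.range n, |2 * (i : ℤ) - ((n : ℤ) - 1)| = ((n ^ 2 / 2 : ℕ) : ℤ) := by
  induction n using Nat.twoStepInduction with
  | zero => simp
  | one => simp
  | more n ih _ =>
    have hdiv : (n + 2) ^ 2 / 2 = n ^ 2 / 2 + (2 * n + 2) := by
      rw [show (n + 2) ^ 2 = n ^ 2 + (2 * n + 2) * 2 by ring,
        Nat.add_mul_div_right _ _ two_pos]
    rw [Finset.sum_range_succ, Finset.sum_range_succ', hdiv,
      Nat.cast_add (n ^ 2 / 2), ← ih]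
    have hshift : ∀ i ∈ Finset.range n,
        |2 * ((i + 1 : ℕ) : ℤ) - (((n + 2 : ℕ) : ℤ) - 1)| = |2 * (i : ℤ) - ((n : ℤ) - 1)| := by
      intro i _
      congr 1
      push_cast
      ring
    have hfirst : |2 * ((0 : ℕ) : ℤ) - (((n + 2 : ℕ) : ℤ) - 1)| = n + 1 := by
      rw [abs_of_nonpos] <;> push_cast <;> linarith
    have hlast : |2 * ((n + 1 : ℕ) : ℤ) - (((n + 2 : ℕ) : ℤ) - 1)| = n + 1 := by
      rw [abs_of_nonneg] <;> push_cast <;> linarith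
    rw [Finset.sum_congr rfl hshift, hfirst, hlast]
    push_cast
    ring

theorem sum_perm_abs_two_mul_sub {n : ℕ} (σ : Equiv.Perm (Fin n)) :
    ∑ i : Fin n, |2 * ((σ i : ℕ) : ℤ) - ((n : ℤ) - 1)| = ((n ^ 2 / 2 : ℕ) : ℤ) := by
  rw [Equiv.sum_comp σ (fun i : Fin n => |2 * ((i : ℕ) : ℤ) - ((n : ℤ) - 1)|),
    Fin.sum_univ_eq_sum_range (fun i : ℕ => |2 * (i : ℤ) - ((n : ℤ) - 1)|) n,
    sum_range_abs_two_mul_sub]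

theorem footrule_nonneg {n : ℕ} (σ τ : Equiv.Perm (Fin n)) : 0 ≤ footrule σ τ :=
  Finset.sum_nonneg fun _ _ => abs_nonneg _

theorem footrule_le {n : ℕ} (σ τ : Equiv.Perm (Fin n)) :
    footrule σ τ ≤ ((n ^ 2 / 2 : ℕ) : ℤ) := by
  have h : 2 * footrule σ τ ≤
      ∑ i : Fin n, (|2 * ((σ i : ℕ) : ℤ) - ((n : ℤ) - 1)| +
        |2 * ((τ i : ℕ) : ℤ) - ((n : ℤ) - 1)|) := by
    rw [footrule, Finset.mul_sum]
    refine Finset.sum_le_sum fun i _ => ?_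
    grind
  rw [Finset.sum_add_distrib, sum_perm_abs_two_mul_sub, sum_perm_abs_two_mul_sub] at h
  linarith

theorem footrule_eq_zero_iff {n : ℕ} (σ τ : Equiv.Perm (Fin n)) :
    footrule σ τ = 0 ↔ σ = τ := by
  rw [footrule, Finset.sum_eq_zero_iff_of_nonneg fun _ _ => abs_nonneg _, Equiv.ext_iff]
  simp [sub_eq_zero, Fin.ext_iff]

/-- For every integer `n ≥ 2` and all permutations `σ, τ` of `{1,…,n}`, the normalized SRD
score `D(σ,τ)/⌊n²/2⌋` lies in `[0,1]`, and it equals `0` if and only if `σ = τ`. -/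
theorem normalized_srd_mem_unit_interval (n : ℕ) (hn : 2 ≤ n) (σ τ : Equiv.Perm (Fin n)) :
    0 ≤ (footrule σ τ : ℝ) / ((n ^ 2 / 2 : ℕ) : ℝ) ∧
    (footrule σ τ : ℝ) / ((n ^ 2 / 2 : ℕ) : ℝ) ≤ 1 ∧
    ((footrule σ τ : ℝ) / ((n ^ 2 / 2 : ℕ) : ℝ) = 0 ↔ σ = τ) := by
  have hpos : (0 : ℝ) < ((n ^ 2 / 2 : ℕ) : ℝ) := by
    have : 0 < n ^ 2 / 2 := Nat.div_pos (by nlinarith) two_pos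
    exact_mod_cast this
  refine ⟨div_nonneg (by exact_mod_cast footrule_nonneg σ τ) hpos.le, ?_, ?_⟩
  · rw [div_le_one hpos]
    simpa only [Int.cast_natCast] using Int.cast_le (R := ℝ).mpr (footrule_le σ τ)
  · rw [div_eq_zero_iff, or_iff_left hpos.ne', Int.cast_eq_zero, footrule_eq_zero_iff]
end

section
/- There exists a constant C > 0 such that for every integer n ≥ 1, if p and r are permutations of {1,…,n} chosen independently and uniformly at random and D(p,r) = Σ_{i=1}^n |p(i) − r(i)|, then |E[D(p,r)] − n²/3| ≤ C·n and |Var(D(p,r)) − 2n³/45| ≤ C·n²; that is, E[D(p,r)] = n²/3 + O(n) and Var(D(p,r)) = 2n³/45 + O(n²). -/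
/-- The expected value of the footrule distance `D(p,r)` when `p` and `r` are two
permutations of `{1,…,n}` chosen independently and uniformly at random, i.e. the average
of `D` over the uniform probability measure on `S_n × S_n`. -/
noncomputable def expFootrule (n : ℕ) : ℝ :=
  (∑ pr : Equiv.Perm (Fin n) × Equiv.Perm (Fin n), (footrule pr.1 pr.2 : ℝ)) /
    (Fintype.card (Equiv.Perm (Fin n) × Equiv.Perm (Fin n)) : ℝ)

/-- The variance `E[(D − E[D])²]` of the footrule distance `D(p,r)` when `p` and `r` are
two permutations of `{1,…,n}` chosen independently and uniformly at random. -/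
noncomputable def varFootrule (n : ℕ) : ℝ :=
  (∑ pr : Equiv.Perm (Fin n) × Equiv.Perm (Fin n),
      ((footrule pr.1 pr.2 : ℝ) - expFootrule n) ^ 2) /
    (Fintype.card (Equiv.Perm (Fin n) × Equiv.Perm (Fin n)) : ℝ)

open Finset Equiv in
theorem card_mul_sum_perm_apply {α : Type*} [Fintype α] [DecidableEq α] (g : α → ℝ) (i : α) :
    (Fintype.card α : ℝ) * ∑ s : Perm α, g (s i) =
      (Fintype.card (Perm α) : ℝ) * ∑ k, g k := by
  have h (k : α) : ∑ s : Perm α, g (s k) = ∑ s : Perm α, g (s i) := by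
    rw [← Equiv.sum_comp (Equiv.mulRight (swap i k))]
    simp
  calc (Fintype.card α : ℝ) * ∑ s : Perm α, g (s i)
      = ∑ k, ∑ s : Perm α, g (s k) := by simp [h]
    _ = ∑ s : Perm α, ∑ k, g (s k) := sum_comm
    _ = ∑ _s : Perm α, ∑ k, g k := sum_congr rfl fun s _ => Equiv.sum_comp s g
    _ = _ := by simp

open Finset Equiv in
theorem sum_perm_mul_apply_of_ne {α : Type*} [Fintype α] [DecidableEq α] (g h : α → ℝ)
    (hh : ∑ k, h k = 0) {i j : α} (hij : i ≠ j) :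
    ((Fintype.card α : ℝ) - 1) * ∑ s : Perm α, g (s i) * h (s j) =
      -∑ s : Perm α, g (s i) * h (s i) := by
  have key (k : α) (hk : k ≠ i) :
      ∑ s : Perm α, g (s i) * h (s k) = ∑ s : Perm α, g (s i) * h (s j) := by
    rw [← Equiv.sum_comp (Equiv.mulRight (swap j k))]
    simp [swap_apply_of_ne_of_ne hij hk.symm]
  have total : ∑ k, ∑ s : Perm α, g (s i) * h (s k) = 0 := by
    rw [sum_comm]
    refine sum_eq_zero fun s _ => ?_
    rw [← mul_sum, Equiv.sum_comp s h, hh, mul_zero]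
  rw [← add_sum_erase univ _ (mem_univ i),
    sum_congr rfl fun k hk => key k (ne_of_mem_erase hk)] at total
  have hcard : ((univ.erase i).card : ℝ) = (Fintype.card α : ℝ) - 1 := by
    rw [card_erase_of_mem (mem_univ i), card_univ,
      Nat.cast_pred (Fintype.card_pos_iff.mpr ⟨i⟩)]
  rw [sum_const, nsmul_eq_mul, hcard] at total
  linarith

open Finset Equiv in
/-- Hoeffding's second moment identity for the permutation statistic `∑ i, f i (s i)` of a
doubly centred matrix `f`. -/
theorem sum_perm_sq_of_centered {α : Type*} [Fintype α] [DecidableEq α] (f : α → α → ℝ)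
    (hrow : ∀ i, ∑ j, f i j = 0) (hcol : ∀ j, ∑ i, f i j = 0) :
    ((Fintype.card α : ℝ) - 1) * ∑ s : Perm α, (∑ i, f i (s i)) ^ 2 =
      (Fintype.card (Perm α) : ℝ) * ∑ i, ∑ j, f i j ^ 2 := by
  have hi (i : α) : ((Fintype.card α : ℝ) - 1) * ∑ j, ∑ s : Perm α, f i (s i) * f j (s j) =
      (Fintype.card α : ℝ) * ∑ s : Perm α, f i (s i) ^ 2 := by
    have hdiag : ∑ j, ∑ s : Perm α, f i (s i) * f j (s i) = 0 := by
      rw [sum_comm]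
      refine sum_eq_zero fun s _ => ?_
      rw [← mul_sum, hcol, mul_zero]
    rw [← add_sum_erase univ _ (mem_univ i)] at hdiag ⊢
    rw [mul_add, mul_sum (univ.erase i), sum_congr rfl fun j hj => sum_perm_mul_apply_of_ne (f i) (f j) (hrow j)
      (ne_of_mem_erase hj).symm, sum_neg_distrib]
    simp only [pow_two]
    linarith
  calc ((Fintype.card α : ℝ) - 1) * ∑ s : Perm α, (∑ i, f i (s i)) ^ 2
      = ∑ i, ((Fintype.card α : ℝ) - 1) * ∑ j, ∑ s : Perm α, f i (s i) * f j (s j) := by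
        rw [← mul_sum]
        congr 1
        simp only [pow_two, sum_mul_sum]
        rw [sum_comm]
        exact sum_congr rfl fun i _ => sum_comm
    _ = ∑ i, (Fintype.card (Perm α) : ℝ) * ∑ j, f i j ^ 2 :=
        sum_congr rfl fun i _ => by
          rw [hi, card_mul_sum_perm_apply (fun k => f i k ^ 2) i]
    _ = _ := by rw [mul_sum]

theorem footrule_eq_footrule_one {n : ℕ} (p r : Equiv.Perm (Fin n)) :
    footrule p r = footrule 1 (r * p⁻¹) := by
  unfold footrule
  rw [← Equiv.sum_comp p (fun i => |(((1 : Equiv.Perm (Fin n)) i : ℕ) : ℤ) -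
    (((r * p⁻¹) i : ℕ) : ℤ)|)]
  simp

theorem average_footrule (n : ℕ) (F : ℝ → ℝ) :
    (∑ pr : Equiv.Perm (Fin n) × Equiv.Perm (Fin n), F (footrule pr.1 pr.2)) /
        (Fintype.card (Equiv.Perm (Fin n) × Equiv.Perm (Fin n)) : ℝ) =
      (∑ s : Equiv.Perm (Fin n), F (footrule 1 s)) / (Fintype.card (Equiv.Perm (Fin n)) : ℝ) := by
  have h (p : Equiv.Perm (Fin n)) : ∑ r, F (footrule p r) =
      ∑ s : Equiv.Perm (Fin n), F (footrule 1 s) := by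
    rw [← Equiv.sum_comp (Equiv.mulRight p⁻¹) (fun s => F (footrule 1 s))]
    exact Finset.sum_congr rfl fun r _ => by rw [footrule_eq_footrule_one]; rfl
  have hc : (Fintype.card (Equiv.Perm (Fin n)) : ℝ) ≠ 0 := by
    exact_mod_cast Fintype.card_ne_zero
  rw [Fintype.sum_prod_type]
  simp only [h, Finset.sum_const, Finset.card_univ, nsmul_eq_mul, Fintype.card_prod, Nat.cast_mul]
  field_simp

theorem sum_range_abs_sub (i n : ℕ) (h : i ≤ n) :
    ∑ j ∈ Finset.range n, |(i : ℝ) - j| = (i : ℝ) ^ 2 + (1 - n) * i + (n ^ 2 - n) / 2 := by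
  induction n, h using Nat.le_induction with
  | base =>
    have h1 : ∑ j ∈ Finset.range i, |(i : ℝ) - j| = ∑ j ∈ Finset.range i, ((i : ℝ) - j) :=
      Finset.sum_congr rfl fun j hj => abs_of_nonneg
        (sub_nonneg.mpr (by exact_mod_cast (Finset.mem_range.mp hj).le))
    have h2 (x : ℝ) (m : ℕ) :
        ∑ j ∈ Finset.range m, (x - j) = m * x - m * (m - 1) / 2 := by
      induction m with
      | zero => simp
      | succ m ih => rw [Finset.sum_range_succ, ih]; push_cast; ring
    rw [h1, h2]
    ring
  | succ n hn ih =>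
    have : (i : ℝ) ≤ n := by exact_mod_cast hn
    rw [Finset.sum_range_succ, ih, abs_of_nonpos (by linarith)]
    push_cast
    ring

theorem sum_range_quadratic (b c : ℝ) (m : ℕ) :
    ∑ i ∈ Finset.range m, ((i : ℝ) ^ 2 + b * i + c) =
      (m - 1) * m * (2 * m - 1) / 6 + b * (m * (m - 1) / 2) + c * m := by
  induction m with
  | zero => simp
  | succ m ih => rw [Finset.sum_range_succ, ih]; push_cast; ring

theorem sum_range_quadratic_sq (b c : ℝ) (m : ℕ) :
    ∑ i ∈ Finset.range m, ((i : ℝ) ^ 2 + b * i + c) ^ 2 =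
      (m - 1) * m * (2 * m - 1) * (3 * m ^ 2 - 3 * m - 1) / 30 +
        2 * b * (m * (m - 1) / 2) ^ 2 + (b ^ 2 + 2 * c) * ((m - 1) * m * (2 * m - 1) / 6) +
        2 * b * c * (m * (m - 1) / 2) + c ^ 2 * m := by
  induction m with
  | zero => simp
  | succ m ih => rw [Finset.sum_range_succ, ih]; push_cast; ring

theorem sum_fin_abs_sub {n : ℕ} (i : Fin n) :
    ∑ j : Fin n, |((i : ℕ) : ℝ) - (j : ℕ)| =
      ((i : ℕ) : ℝ) ^ 2 + (1 - n) * (i : ℕ) + (n ^ 2 - n) / 2 := by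
  rw [Fin.sum_univ_eq_sum_range (fun j => |((i : ℕ) : ℝ) - j|), sum_range_abs_sub _ _ i.2.le]

theorem sum_fin_sum_abs_sub (n : ℕ) :
    ∑ i : Fin n, ∑ j : Fin n, |((i : ℕ) : ℝ) - (j : ℕ)| = n * (n ^ 2 - 1) / 3 := by
  simp only [sum_fin_abs_sub]
  rw [Fin.sum_univ_eq_sum_range (fun i => (i : ℝ) ^ 2 + (1 - n) * i + (n ^ 2 - n) / 2),
    sum_range_quadratic]
  ring

theorem sum_fin_sum_abs_sub_sq (n : ℕ) :
    ∑ i : Fin n, (∑ j : Fin n, |((i : ℕ) : ℝ) - (j : ℕ)|) ^ 2 =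
      n * (n ^ 2 - 1) * (7 * n ^ 2 - 8) / 60 := by
  simp only [sum_fin_abs_sub]
  rw [Fin.sum_univ_eq_sum_range (fun i => ((i : ℝ) ^ 2 + (1 - n) * i + (n ^ 2 - n) / 2) ^ 2),
    sum_range_quadratic_sq]
  ring

theorem sum_fin_sum_sub_sq (n : ℕ) :
    ∑ i : Fin n, ∑ j : Fin n, |((i : ℕ) : ℝ) - (j : ℕ)| ^ 2 = n ^ 2 * (n ^ 2 - 1) / 6 := by
  have h (i : Fin n) : ∑ j : Fin n, |((i : ℕ) : ℝ) - (j : ℕ)| ^ 2 =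
      n * (((i : ℕ) : ℝ) ^ 2 + (1 - n) * (i : ℕ) + (n - 1) * (2 * n - 1) / 6) := by
    have h1 (j : Fin n) : |((i : ℕ) : ℝ) - (j : ℕ)| ^ 2 =
        ((j : ℕ) : ℝ) ^ 2 + (-2 * (i : ℕ)) * (j : ℕ) + ((i : ℕ) : ℝ) ^ 2 := by
      rw [sq_abs]; ring
    simp only [h1]
    rw [Fin.sum_univ_eq_sum_range
      (fun j => (j : ℝ) ^ 2 + (-2 * (i : ℕ)) * j + ((i : ℕ) : ℝ) ^ 2), sum_range_quadratic]
    ring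
  simp only [h]
  rw [← Finset.mul_sum, Fin.sum_univ_eq_sum_range
    (fun i => (i : ℝ) ^ 2 + (1 - n) * i + (n - 1) * (2 * n - 1) / 6), sum_range_quadratic]
  ring

/-- The doubly centred version of the matrix `|i - j|`. -/
noncomputable def centeredDist (n : ℕ) (i j : Fin n) : ℝ :=
  |((i : ℕ) : ℝ) - (j : ℕ)| - (∑ k : Fin n, |((i : ℕ) : ℝ) - (k : ℕ)|) / n -
    (∑ k : Fin n, |((j : ℕ) : ℝ) - (k : ℕ)|) / n + ((n : ℝ) ^ 2 - 1) / (3 * n)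

theorem centeredDist_comm (n : ℕ) (i j : Fin n) : centeredDist n i j = centeredDist n j i := by
  unfold centeredDist
  rw [abs_sub_comm]
  ring

theorem sum_centeredDist {n : ℕ} (hn : 1 ≤ n) (i : Fin n) : ∑ j, centeredDist n i j = 0 := by
  have : (n : ℝ) ≠ 0 := by positivity
  unfold centeredDist
  simp only [Finset.sum_add_distrib, Finset.sum_sub_distrib, ← Finset.sum_div,
    sum_fin_sum_abs_sub, Finset.sum_const, Finset.card_univ, Fintype.card_fin, nsmul_eq_mul]
  field_simp
  ring

theorem sum_centeredDist_sq {n : ℕ} (hn : 1 ≤ n) :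
    ∑ i, ∑ j, centeredDist n i j ^ 2 = ((n : ℝ) ^ 2 - 1) * (2 * n ^ 2 + 7) / 45 := by
  have hn0 : (n : ℝ) ≠ 0 := by positivity
  have hrow (i : Fin n) : ∑ j, centeredDist n i j ^ 2 =
      ∑ j : Fin n, |((i : ℕ) : ℝ) - (j : ℕ)| * centeredDist n i j -
        ∑ j : Fin n, (∑ k : Fin n, |((j : ℕ) : ℝ) - (k : ℕ)|) / n * centeredDist n i j := by
    have h : ∑ j, (((n : ℝ) ^ 2 - 1) / (3 * n) -
        (∑ k : Fin n, |((i : ℕ) : ℝ) - (k : ℕ)|) / n) * centeredDist n i j = 0 := by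
      rw [← Finset.mul_sum, sum_centeredDist hn, mul_zero]
    rw [← Finset.sum_sub_distrib, ← add_zero (∑ j, (_ - _)), ← h, ← Finset.sum_add_distrib]
    refine Finset.sum_congr rfl fun j _ => ?_
    rw [pow_two]
    nth_rewrite 1 [centeredDist]
    ring
  have hcross : ∑ i, ∑ j : Fin n,
      (∑ k : Fin n, |((j : ℕ) : ℝ) - (k : ℕ)|) / n * centeredDist n i j = 0 := by
    rw [Finset.sum_comm]
    refine Finset.sum_eq_zero fun j _ => ?_
    simp only [centeredDist_comm n _ j]
    rw [← Finset.mul_sum, sum_centeredDist hn, mul_zero]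
  simp only [hrow]
  rw [Finset.sum_sub_distrib, hcross, sub_zero]
  have hmain (i : Fin n) : ∑ j : Fin n, |((i : ℕ) : ℝ) - (j : ℕ)| * centeredDist n i j =
      ∑ j : Fin n, |((i : ℕ) : ℝ) - (j : ℕ)| ^ 2 -
        (∑ j : Fin n, |((i : ℕ) : ℝ) - (j : ℕ)|) ^ 2 / n -
        ∑ j : Fin n, |((i : ℕ) : ℝ) - (j : ℕ)| * (∑ k : Fin n, |((j : ℕ) : ℝ) - (k : ℕ)|) / n +
        (∑ j : Fin n, |((i : ℕ) : ℝ) - (j : ℕ)|) * (((n : ℝ) ^ 2 - 1) / (3 * n)) := by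
    rw [pow_two (∑ j : Fin n, |((i : ℕ) : ℝ) - (j : ℕ)|), mul_div_assoc, Finset.sum_mul,
      Finset.sum_mul, ← Finset.sum_sub_distrib, ← Finset.sum_sub_distrib,
      ← Finset.sum_add_distrib]
    refine Finset.sum_congr rfl fun j _ => ?_
    rw [centeredDist]
    ring
  have hswap : ∑ i : Fin n, ∑ j : Fin n,
      |((i : ℕ) : ℝ) - (j : ℕ)| * (∑ k : Fin n, |((j : ℕ) : ℝ) - (k : ℕ)|) / n =
      (∑ j : Fin n, (∑ k : Fin n, |((j : ℕ) : ℝ) - (k : ℕ)|) ^ 2) / n := by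
    rw [Finset.sum_comm, Finset.sum_div]
    refine Finset.sum_congr rfl fun j _ => ?_
    rw [← Finset.sum_div, ← Finset.sum_mul, pow_two]
    simp only [abs_sub_comm _ ((j : ℕ) : ℝ)]
  simp only [hmain]
  rw [Finset.sum_add_distrib, Finset.sum_sub_distrib, Finset.sum_sub_distrib, hswap,
    ← Finset.sum_div, ← Finset.sum_mul, sum_fin_sum_abs_sub, sum_fin_sum_abs_sub_sq,
    sum_fin_sum_sub_sq]
  field_simp
  ring

theorem footrule_one_eq {n : ℕ} (hn : 1 ≤ n) (s : Equiv.Perm (Fin n)) :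
    (footrule 1 s : ℝ) = ∑ i, centeredDist n i (s i) + ((n : ℝ) ^ 2 - 1) / 3 := by
  have hn0 : (n : ℝ) ≠ 0 := by positivity
  unfold centeredDist footrule
  simp only [Finset.sum_add_distrib, Finset.sum_sub_distrib, ← Finset.sum_div,
    Equiv.sum_comp s (fun j => ∑ k : Fin n, |((j : ℕ) : ℝ) - (k : ℕ)|),
    sum_fin_sum_abs_sub, Finset.sum_const, Finset.card_univ, Fintype.card_fin, nsmul_eq_mul]
  push_cast
  simp only [id_eq]
  field_simp
  ring

theorem expFootrule_eq {n : ℕ} (hn : 1 ≤ n) : expFootrule n = ((n : ℝ) ^ 2 - 1) / 3 := by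
  have hn0 : (n : ℝ) ≠ 0 := by positivity
  have hc : (Fintype.card (Equiv.Perm (Fin n)) : ℝ) ≠ 0 := by
    exact_mod_cast Fintype.card_ne_zero
  have hzero (i : Fin n) : ∑ s : Equiv.Perm (Fin n), centeredDist n i (s i) = 0 := by
    have h := card_mul_sum_perm_apply (centeredDist n i) i
    rw [sum_centeredDist hn, mul_zero, Fintype.card_fin] at h
    exact (mul_eq_zero.mp h).resolve_left hn0
  unfold expFootrule
  rw [average_footrule n (fun x => x)]
  simp only [footrule_one_eq hn]
  rw [Finset.sum_add_distrib, Finset.sum_comm, Finset.sum_eq_zero fun i _ => hzero i,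
    Finset.sum_const, Finset.card_univ, nsmul_eq_mul]
  field_simp
  ring

theorem varFootrule_eq {n : ℕ} (hn : 2 ≤ n) :
    varFootrule n = ((n : ℝ) + 1) * (2 * n ^ 2 + 7) / 45 := by
  have hn1 : 1 ≤ n := by omega
  have hc : (Fintype.card (Equiv.Perm (Fin n)) : ℝ) ≠ 0 := by
    exact_mod_cast Fintype.card_ne_zero
  have hsub : (n : ℝ) - 1 ≠ 0 := by
    have : (2 : ℝ) ≤ n := by exact_mod_cast hn
    linarith
  have h := sum_perm_sq_of_centered (centeredDist n) (sum_centeredDist hn1)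
    (fun j => by simp only [centeredDist_comm n _ j, sum_centeredDist hn1])
  rw [sum_centeredDist_sq hn1, Fintype.card_fin] at h
  unfold varFootrule
  rw [average_footrule n (fun x => (x - expFootrule n) ^ 2), expFootrule_eq hn1]
  simp only [footrule_one_eq hn1, add_sub_cancel_right]
  rw [div_eq_iff hc]
  apply mul_left_cancel₀ hsub
  rw [h]
  ring

theorem varFootrule_one : varFootrule 1 = 0 := by
  unfold varFootrule
  rw [expFootrule_eq le_rfl]
  simp [footrule]

/-- There is a constant `C > 0` such that for every `n ≥ 1`,
`|E[D(p,r)] − n²/3| ≤ C·n` and `|Var(D(p,r)) − 2n³/45| ≤ C·n²`; that is,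
`E[D] = n²/3 + O(n)` and `Var(D) = 2n³/45 + O(n²)`. -/
theorem expFootrule_varFootrule_asymptotics :
    ∃ C : ℝ, 0 < C ∧ ∀ n : ℕ, 1 ≤ n →
      |expFootrule n - (n : ℝ) ^ 2 / 3| ≤ C * (n : ℝ) ∧
      |varFootrule n - 2 * (n : ℝ) ^ 3 / 45| ≤ C * (n : ℝ) ^ 2 := by
  refine ⟨1, one_pos, fun n hn => ⟨?_, ?_⟩⟩
  · have h1 : (1 : ℝ) ≤ n := by exact_mod_cast hn
    rw [expFootrule_eq hn, abs_le]
    constructor <;> linarith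
  · obtain rfl | h2 := hn.eq_or_lt
    · rw [varFootrule_one]
      norm_num
    · have h2' : (2 : ℝ) ≤ n := by exact_mod_cast h2
      rw [varFootrule_eq h2, abs_le]
      constructor <;> nlinarith
end
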